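/- The kernel of ψ_C is a nilpotent group of nilpotency class at most 2 and has finite index 18! in C; in particular, C is virtually nilpotent (it contains a nilpotent subgroup of finite index). -/

import Mathlib

/-- The vertices of the graph `T`: the 18 triangles of the triangulation of
the torus obtained from the 3×3 square grid with opposite sides identified.
A triangle is labelled by its unit cell `(a, b) : (ℤ/3)²` together with a
Boolean which is `false` for the lower triangle (below the diagonal of the
cell) and `true` for the upper one. -/
abbrev VT : Type := (ZMod 3 × ZMod 3) × Bool

/-- The 27 edges of the graph `T`, joining pairs of distinct triangles which
share a common side: edge `(c, 0)` is dual to the diagonal of the cell `c`,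
edge `(c, 1)` to the left side of `c` and edge `(c, 2)` to the bottom side
of `c`. -/
abbrev ET : Type := (ZMod 3 × ZMod 3) × Fin 3

/-- One endpoint of an edge of `T`. -/
def endA (e : ET) : VT :=
  if e.2 = 1 then (e.1, true) else (e.1, false)

/-- The other endpoint of an edge of `T`. -/
def endB (e : ET) : VT :=
  if e.2 = 0 then (e.1, true)
  else if e.2 = 1 then ((e.1.1 - 1, e.1.2), false)
  else ((e.1.1, e.1.2 - 1), true)

/-- Incidence between edges and vertices of `T`. -/
def incidentT (e : ET) (v : VT) : Prop := v = endA e ∨ v = endB e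

/-- For each of the 9 grid vertices `p` of the torus, the six edges (in cyclic
order) of the hexagonal cycle in `T` formed by the six triangles
containing `p`. -/
def hexEdge (p : ZMod 3 × ZMod 3) : Fin 6 → ET := fun k =>
  if k = 0 then (p, 2)
  else if k = 1 then (p, 0)
  else if k = 2 then (p, 1)
  else if k = 3 then ((p.1 - 1, p.2), 2)
  else if k = 4 then ((p.1 - 1, p.2 - 1), 0)
  else ((p.1, p.2 - 1), 1)

/-- The free-group generator corresponding to an edge `e` of `T`. -/
def fe (e : ET) : FreeGroup ET := FreeGroup.of e

/-- The relations of the presentation of the group `C`: `u_e² = 1`;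
`u_e u_f = u_f u_e` when `e, f` have no common vertex;
`u_e u_f u_e = u_f u_e u_f` when `e, f` share exactly one vertex; and the
cyclic relation `u_{e₁} u_{e₂} u_{e₃} u_{e₄} u_{e₅} = u_{e₂} u_{e₃} u_{e₄} u_{e₅} u_{e₆}`
for each of the nine hexagonal cycles. -/
def CRels : Set (FreeGroup ET) :=
  { r | (∃ e : ET, r = fe e * fe e)
      ∨ (∃ e f : ET, (∀ v : VT, ¬ (incidentT e v ∧ incidentT f v)) ∧
            r = fe e * fe f * (fe f * fe e)⁻¹)
      ∨ (∃ e f : ET, (∃! v : VT, incidentT e v ∧ incidentT f v) ∧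
            r = fe e * fe f * fe e * (fe f * fe e * fe f)⁻¹)
      ∨ (∃ p : ZMod 3 × ZMod 3,
            r = (fe (hexEdge p 0) * fe (hexEdge p 1) * fe (hexEdge p 2) *
                 fe (hexEdge p 3) * fe (hexEdge p 4)) *
                (fe (hexEdge p 1) * fe (hexEdge p 2) * fe (hexEdge p 3) *
                 fe (hexEdge p 4) * fe (hexEdge p 5))⁻¹) }

/-- The group `C`, given by the above presentation. -/
abbrev Cgrp : Type := PresentedGroup CRels

/-- The generator `u_e` of `C` corresponding to the edge `e` of `T`. -/
def uC (e : ET) : Cgrp := PresentedGroup.of e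

/-- The transposition in `S₁₈` exchanging the two triangles joined by the
edge `e` of `T`. -/
def tE (e : ET) : Equiv.Perm VT := Equiv.swap (endA e) (endB e)

open Equiv

/-- The descending product `g (n - m + 1) * ⋯ * g (n - 1) * g n` with `m` factors. -/
def descProd {G : Type*} [Group G] (g : ℕ → G) (n : ℕ) : ℕ → G
  | 0 => 1
  | m + 1 => g (n - m) * descProd g n m

theorem descProd_comm {G : Type*} [Group G] {g : ℕ → G} {n : ℕ}
    (comm : ∀ j ≤ n, ∀ i, i + 1 < j → g i * g j = g j * g i) (i : ℕ) :
    ∀ m, i + m < n → g i * descProd g n m = descProd g n m * g i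
  | 0, _ => by simp [descProd]
  | m + 1, h => by
    rw [descProd, ← mul_assoc, comm _ (by omega) i (by omega), mul_assoc,
      descProd_comm comm i m (by omega), mul_assoc]

theorem descProd_shift {G : Type*} [Group G] {g : ℕ → G} {n : ℕ}
    (comm : ∀ j ≤ n, ∀ i, i + 1 < j → g i * g j = g j * g i)
    (braid : ∀ i < n, g i * g (i + 1) * g i = g (i + 1) * g i * g (i + 1)) (i : ℕ) (hi : i < n) :
    ∀ m, m ≤ n + 1 → n < i + m → g (i + 1) * descProd g n m = descProd g n m * g i
  | 0, _, h => by omega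
  | 1, _, h => by omega
  | m + 2, hm, h => by
    rcases Nat.lt_or_ge n (i + (m + 1)) with h' | h'
    · have hc := comm (i + 1) (by omega) (n - (m + 1)) (by omega)
      rw [descProd, ← mul_assoc, ← hc, mul_assoc,
        descProd_shift comm braid i hi (m + 1) (by omega) h', mul_assoc]
    · obtain rfl : n = i + (m + 1) := by omega
      have hc := descProd_comm comm i m (by omega)
      have e1 : i + (m + 1) - (m + 1) = i := by omega
      have e2 : i + (m + 1) - m = i + 1 := by omega
      rw [descProd, descProd, e1, e2]
      calc g (i + 1) * (g i * (g (i + 1) * descProd g (i + (m + 1)) m))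
          = (g (i + 1) * g i * g (i + 1)) * descProd g (i + (m + 1)) m := by
            simp only [mul_assoc]
        _ = (g i * g (i + 1) * g i) * descProd g (i + (m + 1)) m := by rw [braid i hi]
        _ = _ := by rw [mul_assoc _ (g i), hc]; simp only [mul_assoc]

theorem exists_eq_descProd_mul {G : Type*} [Group G] {g : ℕ → G} {n : ℕ}
    (sq : ∀ i ≤ n, g i * g i = 1)
    (comm : ∀ j ≤ n, ∀ i, i + 1 < j → g i * g j = g j * g i)
    (braid : ∀ i < n, g i * g (i + 1) * g i = g (i + 1) * g i * g (i + 1))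
    {h : G} (hh : h ∈ Subgroup.closure (g '' Set.Iio (n + 1))) :
    ∃ m ≤ n + 1, ∃ k ∈ Subgroup.closure (g '' Set.Iio n), h = descProd g n m * k := by
  have key : ∀ i ≤ n, ∀ y, (∃ m ≤ n + 1, ∃ k ∈ Subgroup.closure (g '' Set.Iio n),
      y = descProd g n m * k) → ∃ m ≤ n + 1, ∃ k ∈ Subgroup.closure (g '' Set.Iio n),
      g i * y = descProd g n m * k := by
    rintro i hi y ⟨m, hm, k, hk, rfl⟩
    rcases lt_trichotomy (i + m) n with h | h | h
    · refine ⟨m, hm, g i * k,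
        mul_mem (Subgroup.subset_closure ⟨i, by simp; omega, rfl⟩) hk, ?_⟩
      rw [← mul_assoc, descProd_comm comm i m h, mul_assoc]
    · refine ⟨m + 1, by omega, k, hk, ?_⟩
      rw [descProd, show n - m = i by omega, mul_assoc]
    · rcases m with _ | m
      · omega
      rcases Nat.lt_or_ge n (i + m) with h' | h'
      · obtain ⟨i, rfl⟩ : ∃ i', i = i' + 1 := ⟨i - 1, by omega⟩
        refine ⟨m + 1, hm, g i * k,
          mul_mem (Subgroup.subset_closure ⟨i, by simp; omega, rfl⟩) hk, ?_⟩
        rw [← mul_assoc, descProd_shift comm braid i (by omega) (m + 1) hm (by omega), mul_assoc]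
      · refine ⟨m, by omega, k, hk, ?_⟩
        rw [descProd, show n - m = i by omega, ← mul_assoc, ← mul_assoc, sq i hi, one_mul]
  have inv : ∀ i ≤ n, (g i)⁻¹ = g i := fun i hi => inv_eq_of_mul_eq_one_left (sq i hi)
  induction hh using Subgroup.closure_induction_left with
  | one => exact ⟨0, by omega, 1, one_mem _, by simp [descProd]⟩
  | mul_left x hx y _ ih =>
    obtain ⟨i, hi, rfl⟩ := hx
    exact key i (Nat.lt_succ_iff.1 hi) y ih
  | inv_mul_cancel x hx y _ ih =>
    obtain ⟨i, hi, rfl⟩ := hx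
    rw [inv i (Nat.lt_succ_iff.1 hi)]
    exact key i (Nat.lt_succ_iff.1 hi) y ih

/-- A group generated by elements satisfying the Coxeter relations of type `A` and mapping to
the adjacent transpositions along a path embeds in the symmetric group. -/
theorem eq_one_of_mem_closure_path {G V : Type*} [Group G] [DecidableEq V] (f : G →* Perm V)
    (g : ℕ → G) (p : ℕ → V) (n : ℕ) (hp : Set.InjOn p (Set.Iic n))
    (hf : ∀ i < n, f (g i) = swap (p i) (p (i + 1)))
    (sq : ∀ i < n, g i * g i = 1)
    (comm : ∀ j < n, ∀ i, i + 1 < j → g i * g j = g j * g i)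
    (braid : ∀ i, i + 1 < n → g i * g (i + 1) * g i = g (i + 1) * g i * g (i + 1)) :
    ∀ h ∈ Subgroup.closure (g '' Set.Iio n), f h = 1 → h = 1 := by
  induction n with
  | zero => simp
  | succ n ih =>
    intro h hh h1
    obtain ⟨m, hm, k, hk, rfl⟩ := exists_eq_descProd_mul (fun i hi => sq i (by omega))
      (fun j hj => comm j (by omega)) (fun i hi => braid i (by omega)) hh
    have hfix : ∀ k ∈ Subgroup.closure (g '' Set.Iio n), f k (p (n + 1)) = p (n + 1) := by
      intro k hk
      induction hk using Subgroup.closure_induction with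
      | mem x hx =>
        obtain ⟨i, hi, rfl⟩ := hx
        have hi : i < n := hi
        rw [hf i (by omega), swap_apply_of_ne_of_ne]
        · intro h
          have := hp (by simp) (by simp; omega) h
          omega
        · intro h
          have := hp (by simp) (by simp; omega) h
          omega
      | one => simp
      | mul x y _ _ hx hy => rw [map_mul, Perm.mul_apply, hy, hx]
      | inv x _ hx => rw [map_inv, Perm.inv_eq_iff_eq, hx]
    have hmove : ∀ m ≤ n + 1, f (descProd g n m) (p (n + 1)) = p (n + 1 - m) := by
      intro m
      induction m with
      | zero => simp [descProd]
      | succ m ihm =>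
        intro hm
        rw [descProd, map_mul, Perm.mul_apply, ihm (by omega), hf _ (by omega),
          show n - m + 1 = n + 1 - m by omega, swap_apply_right]
        congr 1
        omega
    have h2 := congrArg (fun q : Perm V => q (p (n + 1))) h1
    simp only [map_mul, Perm.mul_apply, hfix k hk, hmove m hm, Perm.one_apply] at h2
    have h3 := hp (by simp) (by simp) h2
    obtain rfl : m = 0 := by omega
    simp only [descProd, one_mul] at h1 ⊢
    exact ih (hp.mono (Set.Iic_subset_Iic.2 (by omega))) (fun i hi => hf i (by omega))
      (fun i hi => sq i (by omega)) (fun j hj => comm j (by omega))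
      (fun i hi => braid i (by omega)) k hk h1

/-- The symmetric group lifts along `f` to the subgroup generated by the `g i`. -/
theorem exists_section_of_path {G V : Type*} [Group G] [DecidableEq V] [Finite V] (f : G →* Perm V)
    (g : ℕ → G) (p : ℕ → V) (n : ℕ) (hp : Set.InjOn p (Set.Iic n))
    (hsurj : ∀ v, ∃ i ≤ n, p i = v)
    (hf : ∀ i < n, f (g i) = swap (p i) (p (i + 1)))
    (sq : ∀ i < n, g i * g i = 1)
    (comm : ∀ j < n, ∀ i, i + 1 < j → g i * g j = g j * g i)
    (braid : ∀ i, i + 1 < n → g i * g (i + 1) * g i = g (i + 1) * g i * g (i + 1)) :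
    ∃ σ : Perm V →* G, (∀ π, f (σ π) = π) ∧ ∀ i < n, σ (f (g i)) = g i := by
  set S := Subgroup.closure (g '' Set.Iio n) with hS
  have hg : ∀ i < n, g i ∈ S := fun i hi => Subgroup.subset_closure ⟨i, hi, rfl⟩
  have hinj : Function.Injective (f.comp S.subtype) := by
    rw [injective_iff_map_eq_one]
    rintro ⟨h, hh⟩ h1
    exact Subtype.ext (eq_one_of_mem_closure_path f g p n hp hf sq comm braid h hh h1)
  have hsur : Function.Surjective (f.comp S.subtype) := by
    set T : Set (Perm V) := {π | ∃ i < n, π = swap (p i) (p (i + 1))} with hT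
    have hle : Subgroup.closure T ≤ (f.comp S.subtype).range := by
      rw [Subgroup.closure_le]
      rintro _ ⟨i, hi, rfl⟩
      exact ⟨⟨g i, hg i hi⟩, hf i hi⟩
    have hTs : ∀ π ∈ T, π.IsSwap := by
      rintro _ ⟨i, hi, rfl⟩
      refine ⟨_, _, fun h => ?_, rfl⟩
      have := hp (by simp; omega) (by simp; omega) h
      omega
    have horb : ∀ i ≤ n, ∃ π : Subgroup.closure T, π • p 0 = p i := by
      intro i
      induction i with
      | zero => exact fun _ => ⟨1, one_smul _ _⟩
      | succ i ih =>
        intro hi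
        obtain ⟨π, hπ⟩ := ih (by omega)
        refine ⟨⟨swap (p i) (p (i + 1)), Subgroup.subset_closure ⟨i, by omega, rfl⟩⟩ * π, ?_⟩
        rw [mul_smul, hπ]
        exact swap_apply_left _ _
    have : MulAction.IsPretransitive (Subgroup.closure T) V := by
      refine ⟨fun x y => ?_⟩
      obtain ⟨i, hi, rfl⟩ := hsurj x
      obtain ⟨j, hj, rfl⟩ := hsurj y
      obtain ⟨a, ha⟩ := horb i hi
      obtain ⟨b, hb⟩ := horb j hj
      exact ⟨b * a⁻¹, by rw [← ha, ← hb, mul_smul, inv_smul_smul]⟩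
    rw [closure_of_isSwap_of_isPretransitive hTs] at hle
    exact fun π => hle (Subgroup.mem_top π)
  let e := MulEquiv.ofBijective (f.comp S.subtype) ⟨hinj, hsur⟩
  refine ⟨S.subtype.comp e.symm.toMonoidHom, fun π => e.apply_symm_apply π, fun i hi => ?_⟩
  exact congrArg Subtype.val (e.symm_apply_apply ⟨g i, hg i hi⟩)

theorem exists_perm_apply_eq {V : Type*} [Finite V] {n : ℕ} {a b : Fin n → V}
    (ha : Function.Injective a) (hb : Function.Injective b) :
    ∃ π : Perm V, ∀ i, π (a i) = b i := by
  have := Equiv.Perm.isMultiplyPretransitive V n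
  obtain ⟨π, hπ⟩ := MulAction.exists_smul_eq (Perm V) (⟨a, ha⟩ : Fin n ↪ V) ⟨b, hb⟩
  exact ⟨π, fun i => DFunLike.congr_fun hπ i⟩

section Loops
variable {G V : Type*} [Group G]

/-- A family of elements of `G` indexed by pairs is equivariant when `σ` permutes it by
conjugation. -/
def IsEquivariant (σ : Perm V →* G) (F : V → V → G) : Prop :=
  ∀ π k l, σ π * F k l * (σ π)⁻¹ = F (π k) (π l)

/-- An equivariant family which is multiplicative in both orders. -/
structure IsLoopFamily (σ : Perm V →* G) (F : V → V → G) : Prop where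
  equivariant : IsEquivariant σ F
  mul_swap : ∀ i j, i ≠ j → F i j * F j i = 1
  mul_left : ∀ i j k, i ≠ j → j ≠ k → i ≠ k → F i j * F j k = F i k
  mul_right : ∀ i j k, i ≠ j → j ≠ k → i ≠ k → F j k * F i j = F i k

theorem isEquivariant_one (σ : Perm V →* G) : IsEquivariant σ (fun _ _ => 1) := by
  intro π k l
  simp

theorem IsLoopFamily.flip {σ : Perm V →* G} {F : V → V → G} (h : IsLoopFamily σ F) :
    IsLoopFamily σ (fun i j => F j i) where
  equivariant π k l := h.equivariant π l k
  mul_swap i j hij := h.mul_swap j i hij.symm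
  mul_left i j k hij hjk hik := h.mul_right k j i hjk.symm hij.symm hik.symm
  mul_right i j k hij hjk hik := h.mul_left k j i hjk.symm hij.symm hik.symm

theorem exists_equivariant (σ : Perm V →* G) {i j : V} {x : G}
    (hx : ∀ π : Perm V, π i = i → π j = j → Commute x (σ π)) :
    ∃ F, IsEquivariant σ F ∧ F i j = x := by
  classical
  let F : V → V → G := fun k l =>
    if h : ∃ π : Perm V, π i = k ∧ π j = l then σ h.choose * x * (σ h.choose)⁻¹ else 1
  have hF : ∀ π : Perm V, F (π i) (π j) = σ π * x * (σ π)⁻¹ := by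
    intro π
    have h : ∃ τ : Perm V, τ i = π i ∧ τ j = π j := ⟨π, rfl, rfl⟩
    have hs := h.choose_spec
    simp only [F, dif_pos h]
    set τ := h.choose
    have := hx (π⁻¹ * τ) (by simp [hs.1]) (by simp [hs.2])
    have e := congrArg (fun y => σ π * y * (σ τ)⁻¹) this.eq
    simp only [map_mul, map_inv] at e
    simpa only [mul_assoc, mul_inv_cancel_left, mul_inv_cancel, mul_one] using e.symm
  refine ⟨F, fun π k l => ?_, by simpa using hF 1⟩
  by_cases h : ∃ τ : Perm V, τ i = k ∧ τ j = l
  · obtain ⟨τ, rfl, rfl⟩ := h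
    have := hF (π * τ)
    rw [Perm.mul_apply, Perm.mul_apply] at this
    rw [this, hF, map_mul]
    group
  · have h' : ¬∃ τ : Perm V, τ i = π k ∧ τ j = π l := by
      rintro ⟨τ, h1, h2⟩
      exact h ⟨π⁻¹ * τ, by simp [h1], by simp [h2]⟩
    simp only [F, dif_neg h, dif_neg h']
    simp

/-- Equivariant families which agree at one pair of distinct indices agree off the diagonal. -/
theorem IsEquivariant.eq_of_eq [Finite V] {σ : Perm V →* G} {F F' : V → V → G}
    (hF : IsEquivariant σ F) (hF' : IsEquivariant σ F') {i j : V} (hij : i ≠ j)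
    (h : F i j = F' i j) {k l : V} (hkl : k ≠ l) : F k l = F' k l := by
  obtain ⟨π, hπ⟩ := exists_perm_apply_eq (a := ![i, j]) (b := ![k, l])
    (by simp [Function.Injective, Fin.forall_fin_two, hij, hij.symm])
    (by simp [Function.Injective, Fin.forall_fin_two, hkl, hkl.symm])
  obtain rfl : π i = k := hπ 0
  obtain rfl : π j = l := hπ 1
  rw [← hF, ← hF', h]

variable [DecidableEq V]

theorem commute_of_forall_swap [Finite V] (σ : Perm V →* G) {i j : V} {u : G}
    (hc : ∀ k l, k ≠ i → k ≠ j → l ≠ i → l ≠ j → Commute u (σ (swap k l)))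
    (π : Perm V) (hi : π i = i) (hj : π j = j) : Commute u (σ π) := by
  set S : Set (Perm V) :=
    {τ | ∃ k l, k ≠ i ∧ k ≠ j ∧ l ≠ i ∧ l ≠ j ∧ k ≠ l ∧ τ = swap k l} with hS
  have hswap : ∀ τ ∈ S, τ.IsSwap := by
    rintro _ ⟨k, l, -, -, -, -, h, rfl⟩
    exact ⟨k, l, h, rfl⟩
  have hle : Subgroup.closure S ≤ (Subgroup.centralizer {u}).comap σ := by
    rw [Subgroup.closure_le]
    rintro _ ⟨k, l, h1, h2, h3, h4, -, rfl⟩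
    exact Subgroup.mem_centralizer_singleton_iff.2 (hc k l h1 h2 h3 h4).symm
  have hmem : π ∈ Subgroup.closure S := by
    rw [mem_closure_isSwap hswap]
    refine ⟨Set.toFinite _, fun x => ?_⟩
    by_cases hx : π x = x
    · rw [hx]
      exact MulAction.mem_orbit_self _
    · have hxi : x ≠ i := fun h => hx (h ▸ hi)
      have hxj : x ≠ j := fun h => hx (h ▸ hj)
      refine ⟨⟨swap x (π x), Subgroup.subset_closure
        ⟨x, π x, hxi, hxj, fun h => ?_, fun h => ?_, Ne.symm hx, rfl⟩⟩, swap_apply_left _ _⟩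
      · exact hxi (π.injective (h.trans hi.symm))
      · exact hxj (π.injective (h.trans hj.symm))
  exact (Subgroup.mem_centralizer_singleton_iff.1 (hle hmem)).symm

/-- Transport of a braid relation along a transposition. -/
theorem braid_transport (σ : Perm V →* G) {i j k l : V} {u : G}
    (hc : ∀ k l, k ≠ i → k ≠ j → l ≠ i → l ≠ j → Commute u (σ (swap k l)))
    (hki : k ≠ i) (hkj : k ≠ j) (hli : l ≠ i) (hlj : l ≠ j)
    (hb : u * σ (swap j k) * u = σ (swap j k) * u * σ (swap j k)) :
    u * σ (swap j l) * u = σ (swap j l) * u * σ (swap j l) := by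
  have hu : σ (swap k l) * u * (σ (swap k l))⁻¹ = u := by
    rw [← (hc k l hki hkj hli hlj).eq, mul_inv_cancel_right]
  have hs : σ (swap k l) * σ (swap j k) * (σ (swap k l))⁻¹ = σ (swap j l) := by
    rw [← map_inv, ← map_mul, ← map_mul]
    congr 1
    rw [← swap_apply_apply, swap_apply_left, swap_apply_of_ne_of_ne hkj.symm hlj.symm]
  have := congrArg (MulAut.conj (σ (swap k l))) hb
  simpa only [map_mul, MulAut.conj_apply, hu, hs] using this

/-- An involution commuting with the transpositions away from `i` and `j` and satisfying braid
relations at `i` and at `j` gives rise to a loop family. -/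
theorem exists_isLoopFamily [Finite V] (σ : Perm V →* G) {i j a b : V} {u : G} (hij : i ≠ j)
    (hu : u * u = 1)
    (hc : ∀ k l, k ≠ i → k ≠ j → l ≠ i → l ≠ j → Commute u (σ (swap k l)))
    (hai : a ≠ i) (haj : a ≠ j) (hbi : b ≠ i) (hbj : b ≠ j)
    (ha : u * σ (swap i a) * u = σ (swap i a) * u * σ (swap i a))
    (hb : u * σ (swap j b) * u = σ (swap j b) * u * σ (swap j b)) :
    ∃ F, IsLoopFamily σ F ∧ u = F i j * σ (swap i j) := by
  have hss : ∀ x y : V, σ (swap x y) * σ (swap x y) = 1 := by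
    intro x y
    rw [← map_mul, swap_mul_self, map_one]
  have hsi : ∀ x y : V, (σ (swap x y))⁻¹ = σ (swap x y) := fun x y =>
    inv_eq_of_mul_eq_one_left (hss x y)
  obtain ⟨F, hF, hFij⟩ := exists_equivariant σ (i := i) (j := j) (x := u * σ (swap i j)) (by
    intro π hi hj
    refine (commute_of_forall_swap σ hc π hi hj).mul_left ?_
    rw [commute_iff_eq, ← map_mul, ← map_mul]
    congr 1
    have := Equiv.swap_apply_apply π i j
    rw [hi, hj, eq_mul_inv_iff_mul_eq] at this
    exact this)
  have main : ∀ k, k ≠ i → k ≠ j → F i j * F j k = F i k ∧ F j k * F i j = F i k := by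
    intro k hki hkj
    have hbk := braid_transport σ hc hbi hbj hki hkj hb
    have hak := braid_transport σ (fun k l h1 h2 h3 h4 => hc k l h2 h1 h4 h3) haj hai hkj hki ha
    have e1 : F i k = σ (swap j k) * (u * σ (swap i j)) * σ (swap j k) := by
      have := hF (swap j k) i j
      rw [swap_apply_left, swap_apply_of_ne_of_ne hij hki.symm, hFij, hsi] at this
      exact this.symm
    have e2 : F j k = σ (swap i k) * (σ (swap i j) * u) * σ (swap i k) := by
      have h1 := hF (swap i j) i j
      rw [swap_apply_left, swap_apply_right, hFij, hsi] at h1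
      have h2 := hF (swap i k) j i
      rw [swap_apply_left, swap_apply_of_ne_of_ne hij.symm hkj.symm, ← h1, hsi] at h2
      rw [← h2]
      simp only [mul_assoc, hss, mul_one]
    have p1 : σ (swap i j) * σ (swap i k) * σ (swap i j) = σ (swap j k) := by
      rw [← map_mul, ← map_mul, swap_comm i k, swap_mul_swap_mul_swap hki hkj]
    have p2 : σ (swap i k) * σ (swap i j) * σ (swap i k) = σ (swap j k) := by
      rw [← map_mul, ← map_mul, swap_comm i j, swap_mul_swap_mul_swap hij.symm hkj.symm,
        swap_comm]
    have p3 : σ (swap j k) * σ (swap i k) = σ (swap i j) * σ (swap j k) := by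
      rw [← p2, mul_assoc, hss, mul_one, p2, ← p1, ← mul_assoc, ← mul_assoc, hss, one_mul]
    have p4 : σ (swap i k) * σ (swap i j) = σ (swap i j) * σ (swap j k) := by
      rw [← p1, ← mul_assoc, ← mul_assoc, hss, one_mul]
    constructor
    · rw [hFij, e1, e2]
      calc u * σ (swap i j) * (σ (swap i k) * (σ (swap i j) * u) * σ (swap i k))
          = u * (σ (swap i j) * σ (swap i k) * σ (swap i j)) * u * σ (swap i k) := by
            simp only [mul_assoc]
        _ = σ (swap j k) * u * (σ (swap j k) * σ (swap i k)) := by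
            rw [p1, hbk]; simp only [mul_assoc]
        _ = _ := by rw [p3]; simp only [mul_assoc]
    · rw [hFij, e1, e2]
      calc σ (swap i k) * (σ (swap i j) * u) * σ (swap i k) * (u * σ (swap i j))
          = σ (swap i k) * σ (swap i j) * (u * σ (swap i k) * u) * σ (swap i j) := by
            simp only [mul_assoc]
        _ = (σ (swap i k) * σ (swap i j) * σ (swap i k)) * u * (σ (swap i k) * σ (swap i j)) := by
            rw [hak]; simp only [mul_assoc]
        _ = _ := by rw [p2, p4]; simp only [mul_assoc]
  have trans3 : ∀ i' j' k', i' ≠ j' → j' ≠ k' → i' ≠ k' →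
      F i' j' * F j' k' = F i' k' ∧ F j' k' * F i' j' = F i' k' := by
    intro i' j' k' h1 h2 h3
    obtain ⟨π, hπ⟩ : ∃ π : Perm V, π i = i' ∧ π j = j' := by
      obtain ⟨π, hπ⟩ := exists_perm_apply_eq (a := ![i, j]) (b := ![i', j'])
        (by simp [Function.Injective, Fin.forall_fin_two, hij, hij.symm])
        (by simp [Function.Injective, Fin.forall_fin_two, h1, h1.symm])
      exact ⟨π, hπ 0, hπ 1⟩
    obtain ⟨k, rfl⟩ := π.surjective k'
    obtain ⟨rfl, rfl⟩ := hπ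
    obtain ⟨m1, m2⟩ := main k (fun h => h3 (h ▸ rfl)) (fun h => h2 (h ▸ rfl))
    rw [← hF, ← hF, ← hF, conj_mul, conj_mul, m1, m2]
    exact ⟨rfl, rfl⟩
  refine ⟨F, ⟨hF, ?_, fun i j k h1 h2 h3 => (trans3 i j k h1 h2 h3).1,
    fun i j k h1 h2 h3 => (trans3 i j k h1 h2 h3).2⟩, ?_⟩
  · intro i' j' h1
    obtain ⟨π, hπ⟩ := exists_perm_apply_eq (a := ![i, j]) (b := ![i', j'])
      (by simp [Function.Injective, Fin.forall_fin_two, hij, hij.symm])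
      (by simp [Function.Injective, Fin.forall_fin_two, h1, h1.symm])
    obtain rfl : π i = i' := hπ 0
    obtain rfl : π j = j' := hπ 1
    have h2 := hF (swap i j) i j
    rw [swap_apply_left, swap_apply_right, hFij, hsi] at h2
    rw [← hF, ← hF, conj_mul, hFij, ← h2]
    have : u * σ (swap i j) * (σ (swap i j) * (u * σ (swap i j)) * σ (swap i j)) = 1 := by
      rw [mul_assoc (σ (swap i j)), mul_assoc u _ (σ (swap i j)), hss, mul_one, mul_assoc u,
        ← mul_assoc (σ (swap i j)), hss, one_mul, hu]
    rw [this]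
    simp
  · rw [hFij, mul_assoc, hss, mul_one]

theorem swap_hexagon {h : Fin 6 → V} (hh : Function.Injective h) :
    swap (h 0) (h 1) * swap (h 1) (h 2) * swap (h 2) (h 3) * swap (h 3) (h 4) * swap (h 4) (h 5) =
      swap (h 1) (h 2) * swap (h 2) (h 3) * swap (h 3) (h 4) * swap (h 4) (h 5) *
        swap (h 5) (h 0) := by
  ext x
  by_cases hx : ∃ k, h k = x
  · obtain ⟨k, rfl⟩ := hx
    fin_cases k <;> simp [swap_apply_def, hh.eq_iff]
  · push Not at hx
    simp [swap_apply_def, fun k => (hx k).symm]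

/-- The cyclic relation of a hexagon, expressed through equivariant families. -/
theorem hexagon_relation (σ : Perm V →* G) {A : Fin 6 → V → V → G}
    (hA : ∀ k, IsEquivariant σ (A k)) {h : Fin 6 → V} (hh : Function.Injective h) {u : Fin 6 → G}
    (hu : ∀ k, u k = A k (h k) (h (k + 1)) * σ (swap (h k) (h (k + 1))))
    (rel : u 0 * u 1 * u 2 * u 3 * u 4 = u 1 * u 2 * u 3 * u 4 * u 5) :
    A 0 (h 0) (h 1) * A 1 (h 0) (h 2) * A 2 (h 0) (h 3) * A 3 (h 0) (h 4) * A 4 (h 0) (h 5) =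
      A 1 (h 1) (h 2) * A 2 (h 1) (h 3) * A 3 (h 1) (h 4) * A 4 (h 1) (h 5) *
        A 5 (h 1) (h 0) := by
  have hs := congrArg σ (swap_hexagon hh)
  have mv : ∀ k π a b, σ π * A k a b = A k (π a) (π b) * σ π := fun k π a b => by
    rw [← hA k π a b, inv_mul_cancel_right]
  have mv' : ∀ k π a b y, σ π * (A k a b * y) = A k (π a) (π b) * (σ π * y) :=
    fun k π a b y => by rw [← mul_assoc, mv, mul_assoc]
  have e : ∀ a b : Fin 6, ∀ c : Fin 6, swap (h a) (h b) (h c) = h (swap a b c) := fun a b c => by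
    simp only [swap_apply_def, hh.eq_iff]
    split_ifs <;> rfl
  have e5 : (5 + 1 : Fin 6) = 0 := rfl
  simp only [hu, mul_assoc, mv', map_mul, e, e5] at rel hs
  simp [swap_apply_def] at rel
  rw [hs] at rel
  simpa only [← mul_assoc, mul_left_inj] using rel

end Loops
section TwoStep
open scoped commutatorElement
variable {G V : Type*} [Group G] {σ : Perm V →* G} {X Y : V → V → G}

theorem IsLoopFamily.inv_eq {F : V → V → G} (h : IsLoopFamily σ F) {i j : V} (hij : i ≠ j) :
    (F i j)⁻¹ = F j i :=
  inv_eq_of_mul_eq_one_right (h.mul_swap i j hij)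

theorem IsLoopFamily.commute {F : V → V → G} (h : IsLoopFamily σ F) {i j k l : V} (hij : i ≠ j)
    (hkl : k ≠ l) : Commute (F i j) (F k l) := by
  have chain : ∀ i j k, i ≠ j → j ≠ k → i ≠ k → Commute (F i j) (F j k) := fun i j k h1 h2 h3 =>
    (h.mul_left i j k h1 h2 h3).trans (h.mul_right i j k h1 h2 h3).symm
  have head : ∀ i j l, i ≠ j → j ≠ l → i ≠ l → Commute (F i j) (F j l) ∧ Commute (F i j) (F l j) :=
    fun i j l h1 h2 h3 =>
      ⟨chain i j l h1 h2 h3, by rw [← h.inv_eq h2]; exact (chain i j l h1 h2 h3).inv_right⟩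
  have share : ∀ i j l, i ≠ j → j ≠ l → Commute (F i j) (F j l) ∧ Commute (F i j) (F l j) := by
    intro i j l h1 h2
    by_cases h3 : i = l
    · subst h3
      exact ⟨by rw [← h.inv_eq h1]; exact (Commute.refl _).inv_right, Commute.refl _⟩
    · exact head i j l h1 h2 h3
  by_cases hjk : j = k
  · subst hjk
    exact (share i j l hij hkl).1
  by_cases hjl : j = l
  · subst hjl
    exact (share i j k hij hkl.symm).2
  rw [← h.mul_left k j l (Ne.symm hjk) hjl hkl]
  exact (share i j k hij hjk).2.mul_right (share i j l hij hjl).1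

theorem exists_ne_five [Finite V] (hcard : 6 ≤ Nat.card V) (a b c d e : V) :
    ∃ x, x ≠ a ∧ x ≠ b ∧ x ≠ c ∧ x ≠ d ∧ x ≠ e := by
  classical
  have := Fintype.ofFinite V
  by_contra! H
  have hsub : (Finset.univ : Finset V) ⊆ {a, b, c, d, e} := by
    intro x _
    simp only [Finset.mem_insert, Finset.mem_singleton]
    by_contra! hx
    exact hx.2.2.2.2 (H x hx.1 hx.2.1 hx.2.2.1 hx.2.2.2.1)
  have h1 := Finset.card_le_card hsub
  have h2 : ({a, b, c, d, e} : Finset V).card ≤ 5 := Finset.card_le_five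
  rw [Finset.card_univ, ← Nat.card_eq_fintype_card] at h1
  omega

/-- `a` and `b` commute up to a power of `z`. -/
def CommuteUpTo (z a b : G) : Prop := ∃ n : ℤ, a * b = z ^ n * (b * a)

theorem CommuteUpTo.symm {z a b : G} (h : CommuteUpTo z a b) : CommuteUpTo z b a := by
  obtain ⟨n, hn⟩ := h
  exact ⟨-n, by rw [hn, zpow_neg, inv_mul_cancel_left]⟩

theorem CommuteUpTo.mul_left {z a a' b : G} (hz : Commute z a) (h : CommuteUpTo z a b)
    (h' : CommuteUpTo z a' b) : CommuteUpTo z (a * a') b := by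
  obtain ⟨n, hn⟩ := h
  obtain ⟨m, hm⟩ := h'
  refine ⟨m + n, ?_⟩
  rw [mul_assoc, hm, ← mul_assoc, ← (hz.zpow_left m).eq, mul_assoc, ← mul_assoc a, hn, zpow_add]
  simp only [mul_assoc]

theorem CommuteUpTo.inv_left {z a b : G} (hz : Commute z a) (h : CommuteUpTo z a b) :
    CommuteUpTo z a⁻¹ b := by
  obtain ⟨n, hn⟩ := h
  refine ⟨-n, ?_⟩
  have := (hz.zpow_left n).inv_right.eq
  rw [zpow_neg, eq_inv_mul_iff_mul_eq, ← mul_assoc, this, mul_assoc, inv_mul_eq_iff_eq_mul,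
    ← mul_assoc, hn]
  simp only [mul_assoc, mul_inv_cancel, mul_one]

theorem Commute.commuteUpTo (z : G) {a b : G} (h : Commute a b) : CommuteUpTo z a b :=
  ⟨0, by rw [zpow_zero, one_mul, h.eq]⟩

theorem commuteUpTo_of_mem_closure {S : Set G} {z : G} (hz : ∀ s ∈ S, Commute z s)
    (hS : ∀ s ∈ S, ∀ t ∈ S, CommuteUpTo z s t) {a b : G} (ha : a ∈ Subgroup.closure S)
    (hb : b ∈ Subgroup.closure S) : CommuteUpTo z a b ∧ Commute z a := by
  have hcent : ∀ a ∈ Subgroup.closure S, Commute z a := by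
    intro a ha
    induction ha using Subgroup.closure_induction with
    | mem x hx => exact hz x hx
    | one => exact Commute.one_right z
    | mul x y _ _ hx hy => exact hx.mul_right hy
    | inv x _ hx => exact hx.inv_right
  have step : ∀ b, (∀ s ∈ S, CommuteUpTo z s b) → ∀ a ∈ Subgroup.closure S, CommuteUpTo z a b := by
    intro b hb a ha
    induction ha using Subgroup.closure_induction with
    | mem x hx => exact hb x hx
    | one => exact (Commute.one_left b).commuteUpTo z
    | mul x y hx _ h h' => exact h.mul_left (hcent x hx) h'
    | inv x hx h => exact h.inv_left (hcent x hx)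
  exact ⟨step b (fun s hs => (step s (fun t ht => hS t ht s hs) b hb).symm) a ha, hcent a ha⟩

theorem upperCentralSeries_two_eq_top {S : Set G} {z : G} (hz : ∀ s ∈ S, Commute z s)
    (hS : ∀ s ∈ S, ∀ t ∈ S, CommuteUpTo z s t) {K : Subgroup G} (hK : K ≤ Subgroup.closure S) :
    Subgroup.upperCentralSeries K 2 = ⊤ := by
  rw [eq_top_iff]
  rintro a -
  rw [Subgroup.mem_upperCentralSeries_succ_iff]
  intro b
  rw [Subgroup.upperCentralSeries_one, Subgroup.mem_center_iff]
  intro c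
  obtain ⟨⟨n, hn⟩, -⟩ := commuteUpTo_of_mem_closure hz hS (hK a.2) (hK b.2)
  have hc := (commuteUpTo_of_mem_closure hz hS (hK c.2) (hK c.2)).2
  have hab : (a : G) * b * (a : G)⁻¹ * (b : G)⁻¹ = z ^ n := by
    rw [mul_inv_eq_iff_eq_mul, mul_inv_eq_iff_eq_mul, hn, mul_assoc]
  apply Subtype.ext
  simp only [commutatorElement_def, Subgroup.coe_mul, Subgroup.coe_inv, hab]
  exact (hc.zpow_left n).symm.eq

/-- Two loop families on at least six points which commute at disjoint pairs and satisfy `hrel`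
generate a group whose commutators are powers of one central element. -/
theorem exists_central_commutator [Finite V] (hcard : 6 ≤ Nat.card V)
    (hX : IsLoopFamily σ X) (hY : IsLoopFamily σ Y)
    (hXY : ∀ i j k l, i ≠ j → i ≠ k → i ≠ l → j ≠ k → j ≠ l → k ≠ l → Commute (X i j) (Y k l))
    (hrel : ∀ i j k l, i ≠ j → i ≠ k → i ≠ l → j ≠ k → j ≠ l → k ≠ l →
      Y j i * X j k * X i j * Y i l = X j k * Y j l * X i j) :
    ∃ z : G, (∀ i j, i ≠ j → Commute z (X i j) ∧ Commute z (Y i j)) ∧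
      ∀ i j k l, i ≠ j → k ≠ l → CommuteUpTo z (X i j) (Y k l) := by
  have indL : ∀ i j j' k, i ≠ j → i ≠ j' → i ≠ k → j ≠ k → j' ≠ k →
      ⁅X i j, Y i k⁆ = ⁅X i j', Y i k⁆ := by
    intro i j j' k h1 h2 h3 h4 h5
    by_cases hjj : j = j'
    · rw [hjj]
    have hc := hXY j' j i k (Ne.symm hjj) h2.symm h5 h1.symm h4 h3
    rw [commutatorElement_def, commutatorElement_def, ← hX.mul_left i j' j h2 (Ne.symm hjj) h1,
      mul_inv_rev, mul_assoc (X i j'), hc.eq]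
    group
  have indR : ∀ i j k k', i ≠ j → i ≠ k → i ≠ k' → j ≠ k → j ≠ k' →
      ⁅X i j, Y i k⁆ = ⁅X i j, Y i k'⁆ := by
    intro i j k k' h1 h2 h3 h4 h5
    by_cases hkk : k = k'
    · rw [hkk]
    have hc := hXY i j k' k h1 h3 h2 h5 h4 (Ne.symm hkk)
    rw [commutatorElement_def, commutatorElement_def, ← hY.mul_left i k' k h3 (Ne.symm hkk) h2,
      mul_inv_rev]
    have := hc.inv_left.eq
    calc X i j * (Y i k' * Y k' k) * (X i j)⁻¹ * ((Y k' k)⁻¹ * (Y i k')⁻¹)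
        = X i j * Y i k' * (Y k' k * (X i j)⁻¹) * (Y k' k)⁻¹ * (Y i k')⁻¹ := by group
      _ = _ := by rw [← this]; group
  have ind : ∀ i j k j' k', i ≠ j → i ≠ k → j ≠ k → i ≠ j' → i ≠ k' → j' ≠ k' →
      ⁅X i j, Y i k⁆ = ⁅X i j', Y i k'⁆ := by
    intro i j k j' k' h1 h2 h3 h4 h5 h6
    obtain ⟨l, hi, hj, hk, hj', hk'⟩ := exists_ne_five hcard i j k j' k'
    rw [indL i j l k h1 hi.symm h2 h3 hk, indR i l k k' hi.symm h2 h5 hk hk',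
      indL i l j' k' hi.symm h4 h5 hk' h6]
  have hz : ∀ i, ∃ z, ∀ j k, i ≠ j → i ≠ k → j ≠ k → ⁅X i j, Y i k⁆ = z := by
    intro i
    obtain ⟨j, hj, -⟩ := exists_ne_five hcard i i i i i
    obtain ⟨k, hk, hkj, -⟩ := exists_ne_five hcard i j i i i
    exact ⟨⁅X i j, Y i k⁆, fun j' k' h1 h2 h3 => ind i j' k' j k h1 h2 h3 hj.symm hk.symm hkj.symm⟩
  choose z hz using hz
  have zX : ∀ i l m, i ≠ l → i ≠ m → l ≠ m → Commute (z i) (X l m) := by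
    intro i l m h1 h2 h3
    obtain ⟨j, hj, hjl, hjm, -⟩ := exists_ne_five hcard i l m m m
    obtain ⟨k, hk, hkl, hkm, hkj, -⟩ := exists_ne_five hcard i l m j j
    rw [← hz i j k hj.symm hk.symm hkj.symm, commutatorElement_def]
    have c1 := hX.commute hj.symm h3
    have c2 := (hXY l m i k h3 h1.symm hkl.symm h2.symm hkm.symm hk.symm).symm
    exact ((c1.mul_left c2).mul_left c1.inv_left).mul_left c2.inv_left
  have zY : ∀ i l m, i ≠ l → i ≠ m → l ≠ m → Commute (z i) (Y l m) := by
    intro i l m h1 h2 h3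
    obtain ⟨j, hj, hjl, hjm, -⟩ := exists_ne_five hcard i l m m m
    obtain ⟨k, hk, hkl, hkm, hkj, -⟩ := exists_ne_five hcard i l m j j
    rw [← hz i j k hj.symm hk.symm hkj.symm, commutatorElement_def]
    have c1 := hY.commute hk.symm h3
    have c2 := hXY i j l m hj.symm h1 h2 hjl hjm h3
    exact ((c2.mul_left c1).mul_left c2.inv_left).mul_left c1.inv_left
  have hcomm : ∀ i j k, i ≠ j → i ≠ k → j ≠ k → X i j * Y i k = z i * Y i k * X i j := by
    intro i j k h1 h2 h3
    rw [← hz i j k h1 h2 h3, commutatorElement_def]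
    group
  have transfer : ∀ i j k, i ≠ j → i ≠ k → j ≠ k →
      (X j k)⁻¹ * z j * X j k = Y j i * z i * (Y j i)⁻¹ := by
    intro i j k h1 h2 h3
    obtain ⟨l, hi, hj, hk, -⟩ := exists_ne_five hcard i j k k k
    have h := hrel i j k l h1 h2 hi.symm h3 hj.symm hk.symm
    rw [← hY.mul_left j i l h1.symm hi.symm hj.symm] at h
    have e1 := hcomm j k i h3 h1.symm h2.symm
    have e2 := hcomm i j l h1 hi.symm hj.symm
    have e3 : Y j i * X j k = (z j)⁻¹ * (X j k * Y j i) := by rw [e1]; group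
    rw [e3, mul_assoc _ (X i j), e2] at h
    have h' : (z j)⁻¹ * (X j k * Y j i) * z i * (Y i l * X i j) =
        X j k * Y j i * (Y i l * X i j) := by
      simpa only [mul_assoc] using h
    have h'' := mul_right_cancel h'
    rw [mul_assoc, inv_mul_eq_iff_eq_mul] at h''
    rw [eq_mul_inv_iff_mul_eq, mul_assoc, mul_assoc, inv_mul_eq_iff_eq_mul, ← h'']
    simp only [mul_assoc]
  have zconj : ∀ i j k, i ≠ j → i ≠ k → j ≠ k → z i = (X j k)⁻¹ * z j * X j k := by
    intro i j k h1 h2 h3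
    obtain ⟨m, hi, hj, hk, -⟩ := exists_ne_five hcard i j k k k
    have hc : Commute (Y j i) ((X j k)⁻¹ * z j * X j k) := by
      rw [transfer m j k hj hk h3]
      have c1 := hY.commute h1.symm hj.symm
      exact (c1.mul_right (zY m j i hj hi h1.symm).symm).mul_right c1.inv_right
    rw [transfer i j k h1 h2 h3] at hc ⊢
    have := hc.eq
    rw [inv_mul_cancel_right] at this
    exact (mul_left_cancel this).symm
  have zeq : ∀ i i', z i = z i' := by
    intro i i'
    obtain ⟨j, hi, hi', -⟩ := exists_ne_five hcard i i' i i i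
    obtain ⟨k, ki, ki', kj, -⟩ := exists_ne_five hcard i i' j j j
    rw [zconj i j k hi.symm ki.symm kj.symm, zconj i' j k hi'.symm ki'.symm kj.symm]
  obtain ⟨i₀⟩ : Nonempty V := (Nat.card_pos_iff.1 (by omega)).1
  have cen : ∀ i j, i ≠ j → Commute (z i₀) (X i j) ∧ Commute (z i₀) (Y i j) := by
    intro i j hij
    obtain ⟨k, hi, hj, -⟩ := exists_ne_five hcard i j i i i
    rw [zeq i₀ k]
    exact ⟨zX k i j hi hj hij, zY k i j hi hj hij⟩
  have up₁ : ∀ i l k m, i ≠ l → l ≠ k → l ≠ m → k ≠ m → CommuteUpTo (z i₀) (X i l) (Y k m) := by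
    intro i l k m h1 h2 h3 h4
    have hs : ∀ m, i ≠ m → l ≠ m → CommuteUpTo (z i₀) (X i l) (Y i m) := fun m hi hm =>
      ⟨1, by rw [zpow_one, zeq i₀ i, hcomm i l m h1 hi hm, mul_assoc]⟩
    by_cases hik : i = k
    · subst hik
      exact hs m h4 h3
    by_cases him : i = m
    · subst him
      rw [← hY.inv_eq hik]
      exact ((hs k hik h2).symm.inv_left (cen i k hik).2).symm
    exact (hXY i l k m h1 hik him h2 h3 h4).commuteUpTo _
  refine ⟨z i₀, cen, fun i j k l hij hkl => ?_⟩
  obtain ⟨m, mi, mj, mk, ml, -⟩ := exists_ne_five hcard i j k l l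
  rw [← hX.mul_left i m j mi.symm mj hij, ← hX.inv_eq mj.symm]
  exact (up₁ i m k l mi.symm mk ml hkl).mul_left (cen i m mi.symm).1
    ((up₁ j m k l mj.symm mk ml hkl).inv_left (cen j m mj.symm).1)
end TwoStep


section Relations

/-- The edges `e` and `f` have no common vertex. -/
def EdgesDisjoint (e f : ET) : Prop :=
  endA e ≠ endA f ∧ endA e ≠ endB f ∧ endB e ≠ endA f ∧ endB e ≠ endB f

/-- The edges `e` and `f` have exactly one common vertex. -/
def EdgesMeet (e f : ET) : Prop :=
  (endA e = endA f ∧ endB e ≠ endB f) ∨ (endA e = endB f ∧ endB e ≠ endA f) ∨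
    (endB e = endA f ∧ endA e ≠ endB f) ∨ (endB e = endB f ∧ endA e ≠ endA f)

instance (e f : ET) : Decidable (EdgesDisjoint e f) := by
  unfold EdgesDisjoint
  infer_instance

instance (e f : ET) : Decidable (EdgesMeet e f) := by
  unfold EdgesMeet
  infer_instance

theorem endA_ne_endB : ∀ e, endA e ≠ endB e := by decide +kernel

theorem uC_mul_self (e : ET) : uC e * uC e = 1 :=
  PresentedGroup.one_of_mem (rels := CRels) (Or.inl ⟨e, rfl⟩)

theorem uC_commute {e f : ET} (h : EdgesDisjoint e f) : Commute (uC e) (uC f) := by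
  have := PresentedGroup.one_of_mem (rels := CRels)
    (x := fe e * fe f * (fe f * fe e)⁻¹) (Or.inr (Or.inl ⟨e, f, ?_, rfl⟩))
  · rw [map_mul, map_inv, mul_inv_eq_one] at this
    exact this
  · rintro v ⟨h₁ | h₁, h₂ | h₂⟩
    · exact h.1 (h₁ ▸ h₂)
    · exact h.2.1 (h₁ ▸ h₂)
    · exact h.2.2.1 (h₁ ▸ h₂)
    · exact h.2.2.2 (h₁ ▸ h₂)

theorem uC_braid {e f : ET} (h : EdgesMeet e f) :
    uC e * uC f * uC e = uC f * uC e * uC f := by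
  have := PresentedGroup.one_of_mem (rels := CRels)
    (x := fe e * fe f * fe e * (fe f * fe e * fe f)⁻¹)
    (Or.inr (Or.inr (Or.inl ⟨e, f, ?_, rfl⟩)))
  · rw [map_mul, map_inv, mul_inv_eq_one] at this
    exact this
  · have he := endA_ne_endB e
    have hf := endA_ne_endB f
    unfold incidentT
    rcases h with ⟨h, h'⟩ | ⟨h, h'⟩ | ⟨h, h'⟩ | ⟨h, h'⟩
    · exact ⟨endA e, by simp [h], by grind⟩
    · exact ⟨endA e, by simp [h], by grind⟩
    · exact ⟨endB e, by simp [h], by grind⟩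
    · exact ⟨endB e, by simp [h], by grind⟩

theorem uC_hexagon (p : ZMod 3 × ZMod 3) :
    uC (hexEdge p 0) * uC (hexEdge p 1) * uC (hexEdge p 2) * uC (hexEdge p 3) *
        uC (hexEdge p 4) =
      uC (hexEdge p 1) * uC (hexEdge p 2) * uC (hexEdge p 3) * uC (hexEdge p 4) *
        uC (hexEdge p 5) := by
  have := PresentedGroup.one_of_mem (rels := CRels) (Or.inr (Or.inr (Or.inr ⟨p, rfl⟩)))
  rw [map_mul, map_inv, mul_inv_eq_one] at this
  exact this

theorem hexagon_rotate {G : Type*} [Group G] {u : Fin 6 → G} (sq : ∀ k, u k * u k = 1)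
    (comm : ∀ k, Commute (u k) (u (k + 2)) ∧ Commute (u k) (u (k + 3)) ∧
      Commute (u k) (u (k + 4)))
    (braid : ∀ k, u k * u (k + 1) * u k = u (k + 1) * u k * u (k + 1)) {k : Fin 6}
    (h : u k * u (k + 1) * u (k + 2) * u (k + 3) * u (k + 4) =
      u (k + 1) * u (k + 2) * u (k + 3) * u (k + 4) * u (k + 5)) :
    u (k + 1) * u (k + 2) * u (k + 3) * u (k + 4) * u (k + 5) =
      u (k + 2) * u (k + 3) * u (k + 4) * u (k + 5) * u k := by
  obtain ⟨c2, c3, c4⟩ := comm k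
  have e1 : u (k + 2) * u (k + 3) * u (k + 4) * u (k + 5) =
      u (k + 1) * (u k * u (k + 1) * u (k + 2) * u (k + 3) * u (k + 4)) := by
    rw [h]
    simp only [← mul_assoc, sq, one_mul]
  have c : Commute (u k) (u (k + 2) * u (k + 3) * u (k + 4)) := (c2.mul_right c3).mul_right c4
  rw [e1, ← h]
  calc u k * u (k + 1) * u (k + 2) * u (k + 3) * u (k + 4)
      = u k * u (k + 1) * (u (k + 2) * u (k + 3) * u (k + 4)) := by simp only [mul_assoc]
    _ = (u (k + 1) * u (k + 1)) * (u k * u (k + 1)) * (u k * u k) *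
          (u (k + 2) * u (k + 3) * u (k + 4)) := by rw [sq, sq, one_mul, mul_one]
    _ = u (k + 1) * (u (k + 1) * u k * u (k + 1)) * u k * (u k *
          (u (k + 2) * u (k + 3) * u (k + 4))) := by simp only [mul_assoc]
    _ = u (k + 1) * (u k * u (k + 1)) * (u k * u k) *
          (u (k + 2) * u (k + 3) * u (k + 4) * u k) := by
        rw [← braid, c.eq]; simp only [mul_assoc]
    _ = _ := by rw [sq, mul_one]; simp only [mul_assoc]

theorem hexagon_mem {G : Type*} [Group G] {u : Fin 6 → G} (sq : ∀ k, u k * u k = 1)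
    (comm : ∀ k, Commute (u k) (u (k + 2)) ∧ Commute (u k) (u (k + 3)) ∧
      Commute (u k) (u (k + 4)))
    (braid : ∀ k, u k * u (k + 1) * u k = u (k + 1) * u k * u (k + 1))
    (rel : u 0 * u 1 * u 2 * u 3 * u 4 = u 1 * u 2 * u 3 * u 4 * u 5) {H : Subgroup G}
    (m : Fin 6) (hm : ∀ k, k ≠ m → u k ∈ H) : u m ∈ H := by
  have all : ∀ m : Fin 6, u m * u (m + 1) * u (m + 2) * u (m + 3) * u (m + 4) =
      u (m + 1) * u (m + 2) * u (m + 3) * u (m + 4) * u (m + 5) := by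
    have r0 := rel
    have r1 := hexagon_rotate sq comm braid (k := 0) r0
    have r2 := hexagon_rotate sq comm braid (k := 1) r1
    have r3 := hexagon_rotate sq comm braid (k := 2) r2
    have r4 := hexagon_rotate sq comm braid (k := 3) r3
    have r5 := hexagon_rotate sq comm braid (k := 4) r4
    intro m
    fin_cases m
    exacts [r0, r1, r2, r3, r4, r5]
  have ne : ∀ j : Fin 6, j ≠ 0 → m + j ≠ m := fun j hj h => hj (by simpa using h)
  have h1 := hm _ (ne 1 (by decide))
  have h2 := hm _ (ne 2 (by decide))
  have h3 := hm _ (ne 3 (by decide))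
  have h4 := hm _ (ne 4 (by decide))
  have h5 := hm _ (ne 5 (by decide))
  have h := all m
  rw [← eq_mul_inv_iff_mul_eq, ← eq_mul_inv_iff_mul_eq, ← eq_mul_inv_iff_mul_eq,
    ← eq_mul_inv_iff_mul_eq] at h
  rw [h]
  exact H.mul_mem (H.mul_mem (H.mul_mem (H.mul_mem (H.mul_mem (H.mul_mem (H.mul_mem
    (H.mul_mem h1 h2) h3) h4) h5) (H.inv_mem h4)) (H.inv_mem h3)) (H.inv_mem h2)) (H.inv_mem h1)

theorem uC_hexEdge_mem (p : ZMod 3 × ZMod 3) (m : Fin 6) {H : Subgroup Cgrp}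
    (hm : ∀ k, k ≠ m → uC (hexEdge p k) ∈ H) : uC (hexEdge p m) ∈ H := by
  have hc : ∀ p k, EdgesDisjoint (hexEdge p k) (hexEdge p (k + 2)) ∧
      EdgesDisjoint (hexEdge p k) (hexEdge p (k + 3)) ∧
      EdgesDisjoint (hexEdge p k) (hexEdge p (k + 4)) := by decide +kernel
  have hb : ∀ p k, EdgesMeet (hexEdge p k) (hexEdge p (k + 1)) := by decide +kernel
  exact hexagon_mem (u := fun k => uC (hexEdge p k)) (fun k => uC_mul_self _)
    (fun k => ⟨uC_commute (hc p k).1, uC_commute (hc p k).2.1, uC_commute (hc p k).2.2⟩)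
    (fun k => uC_braid (hb p k)) (uC_hexagon p) m hm

end Relations


section HamiltonianPath

/-- The vertices of a Hamiltonian path of `T`, in order. -/
def pathVertices : List VT :=
  [((0, 0), true), ((0, 1), false), ((0, 1), true), ((2, 1), false), ((2, 0), true),
    ((2, 0), false), ((2, 2), true), ((1, 2), false), ((1, 1), true), ((1, 1), false),
    ((2, 1), true), ((2, 2), false), ((0, 2), true), ((0, 2), false), ((1, 2), true),
    ((1, 0), false), ((1, 0), true), ((0, 0), false)]

/-- The edges of the Hamiltonian path through `pathVertices`, in order. -/
def pathEdges : List ET :=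
  [((0, 1), 2), ((0, 1), 0), ((0, 1), 1), ((2, 1), 2), ((2, 0), 0), ((2, 0), 2), ((2, 2), 1),
    ((1, 2), 2), ((1, 1), 0), ((2, 1), 1), ((2, 2), 2), ((0, 2), 1), ((0, 2), 0), ((1, 2), 1),
    ((1, 0), 2), ((1, 0), 0), ((1, 0), 1)]

/-- The `i`-th vertex of the path. -/
def pathVertex (i : ℕ) : VT := pathVertices.getD i default

/-- The `i`-th edge of the path. -/
def pathEdge (i : ℕ) : ET := pathEdges.getD i default

/-- The edges not on the Hamiltonian path which are determined by it: they close up the hexagons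
around the grid vertices `(0, 1)`, `(2, 2)`, `(1, 0)` and `(0, 0)`. -/
def chordEdges : List ET := [((0, 0), 1), ((2, 2), 0), ((0, 0), 2), ((0, 0), 0)]

/-- The edges which are neither on the path nor chords. -/
def cutEdges : List ET :=
  [((1, 2), 0), ((0, 2), 2), ((1, 1), 1), ((2, 0), 1), ((2, 1), 0), ((1, 1), 2)]

theorem tE_eq_swap {e : ET} {i j : VT}
    (h : (endA e = i ∧ endB e = j) ∨ (endA e = j ∧ endB e = i)) : tE e = swap i j := by
  rcases h with ⟨rfl, rfl⟩ | ⟨rfl, rfl⟩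
  · rfl
  · exact swap_comm _ _

theorem tE_pathEdge : ∀ i < 17, tE (pathEdge i) = swap (pathVertex i) (pathVertex (i + 1)) := by
  have h : ∀ i < 17, (endA (pathEdge i) = pathVertex i ∧ endB (pathEdge i) = pathVertex (i + 1)) ∨
      (endA (pathEdge i) = pathVertex (i + 1) ∧ endB (pathEdge i) = pathVertex i) := by
    decide +kernel
  exact fun i hi => tE_eq_swap (h i hi)

theorem exists_section_tE (ψ : Cgrp →* Perm VT) (hψ : ∀ e, ψ (uC e) = tE e) :
    ∃ σ : Perm VT →* Cgrp, (∀ π, ψ (σ π) = π) ∧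
      ∀ e ∈ pathEdges ++ chordEdges, σ (tE e) = uC e := by
  have hp : ∀ i < 18, ∀ j < 18, pathVertex i = pathVertex j → i = j := by decide +kernel
  have hs : ∀ v, ∃ i < 18, pathVertex i = v := by decide +kernel
  have hc : ∀ j < 17, ∀ i < 17, i + 1 < j → EdgesDisjoint (pathEdge i) (pathEdge j) := by
    decide +kernel
  have hb : ∀ i < 16, EdgesMeet (pathEdge i) (pathEdge (i + 1)) := by decide +kernel
  have hpath : ∀ e ∈ pathEdges, ∃ i < 17, pathEdge i = e := by decide +kernel
  obtain ⟨σ, hσ, hσg⟩ := exists_section_of_path ψ (fun i => uC (pathEdge i)) pathVertex 17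
    (fun i hi j hj => hp i (Nat.lt_succ_of_le hi) j (Nat.lt_succ_of_le hj))
    (fun v => (hs v).imp fun i hi => ⟨Nat.le_of_lt_succ hi.1, hi.2⟩)
    (fun i hi => (hψ _).trans (tE_pathEdge i hi)) (fun i _ => uC_mul_self _)
    (fun j hj i hij => (uC_commute (hc j hj i (by omega) hij)).eq)
    (fun i hi => uC_braid (hb i (by omega)))
  have mem : ∀ e, uC e ∈ σ.range → σ (tE e) = uC e := by
    rintro e ⟨π, hπ⟩
    rw [← hψ, ← hπ, hσ]
  have path : ∀ e ∈ pathEdges, uC e ∈ σ.range := by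
    intro e he
    obtain ⟨i, hi, rfl⟩ := hpath e he
    exact ⟨_, hσg i hi⟩
  have hex : ∀ L : List ET, (∀ e ∈ L, uC e ∈ σ.range) → ∀ p m,
      (∀ k, k ≠ m → hexEdge p k ∈ L) → ∀ e ∈ hexEdge p m :: L, uC e ∈ σ.range := by
    intro L hL p m h e he
    rcases List.mem_cons.1 he with rfl | he
    · exact uC_hexEdge_mem p m fun k hk => hL _ (h k hk)
    · exact hL e he
  have h1 := hex _ path (0, 1) 5 (by decide +kernel)
  have h2 := hex _ h1 (2, 2) 1 (by decide +kernel)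
  have h3 := hex _ h2 (1, 0) 3 (by decide +kernel)
  have h4 := hex _ h3 (0, 0) 1 (by decide +kernel)
  exact ⟨σ, hσ, fun e he => mem e (h4 e ((by decide +kernel : ∀ e ∈ pathEdges ++ chordEdges,
    e ∈ _) e he))⟩

/-- Enlarge a list of vertices along an edge. -/
def growAlong (S : List VT) (e : ET) : List VT :=
  if endA e ∈ S then endB e :: S else if endB e ∈ S then endA e :: S else S

/-- The vertices found from `((0, 0), true)` by going three times through the path edges and
chords which are disjoint from `e`. -/
def reachableAvoiding (e : ET) : List VT :=
  let L := (pathEdges ++ chordEdges).filter fun f => EdgesDisjoint e f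
  (L ++ L.reverse ++ L).foldl growAlong [((0, 0), true)]

theorem commute_swap_trans {G V : Type*} [Group G] [DecidableEq V] {σ : Perm V →* G} {u : G}
    {i j k : V} (h : Commute u (σ (swap i j))) (h' : Commute u (σ (swap j k))) :
    Commute u (σ (swap i k)) := by
  by_cases hij : i = j
  · exact hij ▸ h'
  by_cases hik : i = k
  · rw [hik, swap_self]
    exact (map_one σ).symm ▸ Commute.one_right u
  rw [swap_comm i k, ← swap_mul_swap_mul_swap hij hik, map_mul, map_mul]
  exact (h'.mul_right h).mul_right h'

theorem commute_of_mem_foldl_growAlong {G : Type*} [Group G] {σ : Perm VT →* G} {u : G} {v : VT} :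
    ∀ (L : List ET) (S : List VT), (∀ f ∈ L, Commute u (σ (tE f))) →
      (∀ w ∈ S, Commute u (σ (swap v w))) →
      ∀ w ∈ L.foldl growAlong S, Commute u (σ (swap v w))
  | [], _, _, hS => hS
  | f :: L, S, hL, hS => by
    rw [List.foldl_cons]
    refine commute_of_mem_foldl_growAlong L _ (fun g hg => hL g (List.mem_cons_of_mem _ hg)) ?_
    have hf := hL f List.mem_cons_self
    intro w hw
    rw [growAlong] at hw
    split_ifs at hw with h₁ h₂
    · rcases List.mem_cons.1 hw with rfl | hw
      · exact commute_swap_trans (hS _ h₁) hf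
      · exact hS w hw
    · rcases List.mem_cons.1 hw with rfl | hw
      · exact commute_swap_trans (hS _ h₂) (by rw [swap_comm]; exact hf)
      · exact hS w hw
    · exact hS w hw

/-- The element `uC e` differs from the image of its transposition by a value of the loop
family `F`. -/
structure IsLoopOf (σ : Perm VT →* Cgrp) (e : ET) (i j : VT) (F : VT → VT → Cgrp) : Prop where
  isLoopFamily : IsLoopFamily σ F
  eq : uC e = F i j * σ (swap i j)

theorem IsLoopOf.flip {σ : Perm VT →* Cgrp} {e : ET} {i j : VT} {F : VT → VT → Cgrp}
    (h : IsLoopOf σ e i j F) : IsLoopOf σ e j i (fun k l => F l k) :=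
  ⟨h.isLoopFamily.flip, by rw [swap_comm, ← h.eq]⟩

theorem exists_isLoopOf {σ : Perm VT →* Cgrp}
    (hσ : ∀ e ∈ pathEdges ++ chordEdges, σ (tE e) = uC e) {e : ET} (he : e ∈ cutEdges) {i j : VT}
    (hij : endA e = i ∧ endB e = j) : ∃ F, IsLoopOf σ e i j F := by
  obtain ⟨rfl, rfl⟩ := hij
  have hreach : ∀ e ∈ cutEdges, ∀ v, v = endA e ∨ v = endB e ∨ v ∈ reachableAvoiding e := by
    decide +kernel
  have hnear : ∀ e ∈ cutEdges, ∀ i ∈ [endA e, endB e], ∃ f ∈ pathEdges ++ chordEdges,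
      EdgesMeet e f ∧ (endA f = i ∨ endB f = i) := by
    decide +kernel
  have comm : ∀ w, w ≠ endA e → w ≠ endB e →
      Commute (uC e) (σ (swap ((0, 0), true) w)) := by
    intro w h₁ h₂
    have hw := ((hreach e he w).resolve_left h₁).resolve_left h₂
    refine commute_of_mem_foldl_growAlong _ _ ?_ ?_ w hw
    · intro f hf
      have : f ∈ pathEdges ++ chordEdges ∧ EdgesDisjoint e f := by
        simp only [List.mem_append, List.mem_reverse, List.mem_filter, or_self,
          decide_eq_true_eq] at hf
        exact hf.imp_left List.mem_append.2
      rw [hσ f this.1]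
      exact uC_commute this.2
    · intro w hw
      rw [List.mem_singleton.1 hw, swap_self]
      exact (map_one σ).symm ▸ Commute.one_right _
  have near : ∀ i, i = endA e ∨ i = endB e → ∃ a, a ≠ endA e ∧ a ≠ endB e ∧
      uC e * σ (swap i a) * uC e = σ (swap i a) * uC e * σ (swap i a) := by
    intro i hi
    obtain ⟨f, hf, hm, h⟩ := hnear e he i (by simpa using hi)
    have hm' := hm
    have hf' := endA_ne_endB f
    unfold EdgesMeet at hm'
    obtain ⟨a, h₁, h₂, h⟩ : ∃ a, a ≠ endA e ∧ a ≠ endB e ∧ tE f = swap i a := by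
      rcases h with rfl | rfl
      · exact ⟨endB f, by grind, by grind, rfl⟩
      · exact ⟨endA f, by grind, by grind, swap_comm _ _⟩
    exact ⟨a, h₁, h₂, by rw [← h, hσ f hf, uC_braid hm]⟩
  obtain ⟨a, hai, haj, ha⟩ := near _ (Or.inl rfl)
  obtain ⟨b, hbi, hbj, hb⟩ := near _ (Or.inr rfl)
  obtain ⟨F, hF, h⟩ := exists_isLoopFamily σ (endA_ne_endB e) (uC_mul_self e)
    (fun k l hki hkj hli hlj => commute_swap_trans
      (by rw [swap_comm]; exact comm k hki hkj) (comm l hli hlj)) hai haj hbi hbj ha hb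
  exact ⟨F, hF, h⟩

end HamiltonianPath


section Hexagons

theorem injective_vecCons_three {V : Type*} {i j k : V} (hij : i ≠ j) (hik : i ≠ k)
    (hjk : j ≠ k) : Function.Injective ![i, j, k] := by
  intro a b h
  fin_cases a <;> fin_cases b <;> simp_all [eq_comm]

theorem injective_vecCons_four {V : Type*} {i j k l : V} (hij : i ≠ j) (hik : i ≠ k)
    (hil : i ≠ l) (hjk : j ≠ k) (hjl : j ≠ l) (hkl : k ≠ l) :
    Function.Injective ![i, j, k, l] := by
  intro a b h
  fin_cases a <;> fin_cases b <;> simp_all [eq_comm]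

theorem IsLoopFamily.eq_flip_of_mul_eq_mul {G V : Type*} [Group G] {σ : Perm V →* G}
    {F F' : V → V → G} (hF : IsLoopFamily σ F) (hF' : IsLoopFamily σ F') {a b c d : V}
    (hab : a ≠ b) (hac : a ≠ c) (had : a ≠ d) (hbc : b ≠ c) (hbd : b ≠ d)
    (h : F a c * F' a d = F b c * F' b d) : F a b = F' b a := by
  rw [← hF.mul_right a b c hab hbc hac, ← hF'.mul_left b a d hab.symm had hbd, mul_assoc] at h
  exact mul_right_cancel (mul_left_cancel h)

theorem IsLoopFamily.eq_flip_of_mul_eq {G V : Type*} [Group G] {σ : Perm V →* G}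
    {F F' : V → V → G} (hF' : IsLoopFamily σ F') {a b c : V}
    (hab : a ≠ b) (hac : a ≠ c) (hbc : b ≠ c)
    (h : F a b * F' a c = F' b c) : F a b = F' b a := by
  rw [← hF'.mul_left b a c hab.symm hac hbc] at h
  exact mul_right_cancel h

theorem uC_loop_hexagon {σ : Perm VT →* Cgrp} {A : Fin 6 → VT → VT → Cgrp}
    (hA : ∀ k, IsEquivariant σ (A k)) {h : Fin 6 → VT} (hh : Function.Injective h)
    {p : ZMod 3 × ZMod 3} {E : Fin 6 → ET} (hE : ∀ k, hexEdge p k = E k)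
    (hu : ∀ k, uC (E k) = A k (h k) (h (k + 1)) * σ (swap (h k) (h (k + 1)))) :
    A 0 (h 0) (h 1) * A 1 (h 0) (h 2) * A 2 (h 0) (h 3) * A 3 (h 0) (h 4) * A 4 (h 0) (h 5) =
      A 1 (h 1) (h 2) * A 2 (h 1) (h 3) * A 3 (h 1) (h 4) * A 4 (h 1) (h 5) *
        A 5 (h 1) (h 0) := by
  refine hexagon_relation σ hA hh hu ?_
  have := uC_hexagon p
  simpa only [hE] using this

theorem exists_isLoopOf_flip {σ : Perm VT →* Cgrp}
    (hσ : ∀ e ∈ pathEdges ++ chordEdges, σ (tE e) = uC e) {e : ET} (he : e ∈ cutEdges) {i j : VT}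
    (hij : endA e = i ∧ endB e = j) : ∃ F, IsLoopOf σ e j i F :=
  let ⟨_, hF⟩ := exists_isLoopOf hσ he hij
  ⟨_, hF.flip⟩

/-- Two loop families commuting at disjoint pairs, satisfying the relation coming from the
hexagons which meet three cut edges, such that all the differences between `uC e` and the image
of its transposition are products of their values. -/
theorem exists_isLoopFamily_pair {σ : Perm VT →* Cgrp}
    (hσ : ∀ e ∈ pathEdges ++ chordEdges, σ (tE e) = uC e) :
    ∃ X Y : VT → VT → Cgrp, IsLoopFamily σ X ∧ IsLoopFamily σ Y ∧
      (∀ i j k l, i ≠ j → i ≠ k → i ≠ l → j ≠ k → j ≠ l → k ≠ l →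
        Commute (X i j) (Y k l)) ∧
      (∀ i j k l, i ≠ j → i ≠ k → i ≠ l → j ≠ k → j ≠ l → k ≠ l →
        Y j i * X j k * X i j * Y i l = X j k * Y j l * X i j) ∧
      ∀ e, uC e * (σ (tE e))⁻¹ ∈
        Subgroup.closure {g | ∃ i j, i ≠ j ∧ (g = X i j ∨ g = Y i j)} := by
  obtain ⟨X, hX⟩ := exists_isLoopOf hσ (e := ((1, 2), 0)) (by decide +kernel)
    (i := pathVertex 7) (j := pathVertex 14) (by decide +kernel)
  obtain ⟨Y, hY⟩ := exists_isLoopOf hσ (e := ((0, 2), 2)) (by decide +kernel)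
    (i := pathVertex 13) (j := pathVertex 2) (by decide +kernel)
  obtain ⟨W, hW⟩ := exists_isLoopOf_flip hσ (e := ((1, 1), 1)) (by decide +kernel)
    (i := pathVertex 8) (j := pathVertex 1) (by decide +kernel)
  obtain ⟨P, hP⟩ := exists_isLoopOf hσ (e := ((2, 0), 1)) (by decide +kernel)
    (i := pathVertex 4) (j := pathVertex 15) (by decide +kernel)
  obtain ⟨Q, hQ⟩ := exists_isLoopOf_flip hσ (e := ((2, 1), 0)) (by decide +kernel)
    (i := pathVertex 3) (j := pathVertex 10) (by decide +kernel)
  obtain ⟨R, hR⟩ := exists_isLoopOf_flip hσ (e := ((1, 1), 2)) (by decide +kernel)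
    (i := pathVertex 9) (j := pathVertex 16) (by decide +kernel)
  have X' := hX.isLoopFamily
  have Y' := hY.isLoopFamily
  have W' := hW.isLoopFamily
  have P' := hP.isLoopFamily
  have Q' := hQ.isLoopFamily
  have R' := hR.isLoopFamily
  have one := isEquivariant_one σ
  have triv : ∀ e i j, e ∈ pathEdges ++ chordEdges →
      (endA e = pathVertex i ∧ endB e = pathVertex j ∨
        endA e = pathVertex j ∧ endB e = pathVertex i) →
      uC e = 1 * σ (swap (pathVertex i) (pathVertex j)) := by
    intro e i j he h
    rw [← hσ e he, one_mul, tE_eq_swap h]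
  have PX : ∀ {i j}, i ≠ j → P i j = X i j := by
    have h : 1 * 1 * P (pathVertex 6) (pathVertex 15) * 1 * X (pathVertex 7) (pathVertex 6) =
        1 * P (pathVertex 5) (pathVertex 15) * 1 * X (pathVertex 7) (pathVertex 5) * 1 :=
      uC_loop_hexagon (σ := σ) (p := (2, 0)) (A := ![fun _ _ => 1, fun _ _ => 1, P,
          fun _ _ => 1, fun i j => X j i, fun _ _ => 1])
        (E := ![((2, 0), 2), ((2, 0), 0), ((2, 0), 1), ((1, 0), 2), ((1, 2), 0), ((2, 2), 1)])
        (h := fun k => pathVertex (![6, 5, 4, 15, 14, 7] k))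
        (by
          intro k
          fin_cases k
          exacts [one, one, P'.equivariant, one, X'.flip.equivariant, one])
        (by decide +kernel) (by decide +kernel)
        (by
          intro k
          fin_cases k
          exacts [triv _ 6 5 (by decide +kernel) (by decide +kernel),
            triv _ 5 4 (by decide +kernel) (by decide +kernel), hP.eq,
            triv _ 15 14 (by decide +kernel) (by decide +kernel), hX.flip.eq,
            triv _ 7 6 (by decide +kernel) (by decide +kernel)])
    simp only [one_mul, mul_one] at h
    intro i j
    exact P'.equivariant.eq_of_eq X'.equivariant (by decide +kernel)
      (P'.eq_flip_of_mul_eq_mul X'.flip (by decide +kernel) (by decide +kernel)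
        (by decide +kernel) (by decide +kernel) (by decide +kernel) h)
  have QY : ∀ {i j}, i ≠ j → Q i j = Y i j := by
    have h : Y (pathVertex 13) (pathVertex 2) * 1 * 1 * 1 * Q (pathVertex 2) (pathVertex 3) =
        1 * 1 * 1 * Q (pathVertex 13) (pathVertex 3) * 1 :=
      uC_loop_hexagon (σ := σ) (p := (0, 2)) (A := ![fun i j => Y j i, fun _ _ => 1,
          fun _ _ => 1, fun _ _ => 1, Q, fun _ _ => 1])
        (E := ![((0, 2), 2), ((0, 2), 0), ((0, 2), 1), ((2, 2), 2), ((2, 1), 0), ((0, 1), 1)])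
        (h := fun k => pathVertex (![2, 13, 12, 11, 10, 3] k))
        (by
          intro k
          fin_cases k
          exacts [Y'.flip.equivariant, one, one, one, Q'.equivariant, one])
        (by decide +kernel) (by decide +kernel)
        (by
          intro k
          fin_cases k
          exacts [hY.flip.eq, triv _ 13 12 (by decide +kernel) (by decide +kernel),
            triv _ 12 11 (by decide +kernel) (by decide +kernel),
            triv _ 11 10 (by decide +kernel) (by decide +kernel), hQ.eq,
            triv _ 3 2 (by decide +kernel) (by decide +kernel)])
    simp only [one_mul, mul_one] at h
    intro i j
    exact Q'.equivariant.eq_of_eq Y'.equivariant (by decide +kernel)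
      (Q'.eq_flip_of_mul_eq (F := fun i j => Y j i) (by decide +kernel) (by decide +kernel)
        (by decide +kernel) h).symm
  have RW : ∀ {i j}, i ≠ j → R i j = W i j := by
    have h : R (pathVertex 16) (pathVertex 9) * 1 * W (pathVertex 1) (pathVertex 16) * 1 * 1 =
        1 * W (pathVertex 1) (pathVertex 9) * 1 * 1 * 1 :=
      uC_loop_hexagon (σ := σ) (p := (1, 1)) (A := ![R, fun _ _ => 1,
          fun i j => W j i, fun _ _ => 1, fun _ _ => 1, fun _ _ => 1])
        (E := ![((1, 1), 2), ((1, 1), 0), ((1, 1), 1), ((0, 1), 2), ((0, 0), 0), ((1, 0), 1)])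
        (h := fun k => pathVertex (![16, 9, 8, 1, 0, 17] k))
        (by
          intro k
          fin_cases k
          exacts [R'.equivariant, one, W'.flip.equivariant, one, one, one])
        (by decide +kernel) (by decide +kernel)
        (by
          intro k
          fin_cases k
          exacts [hR.eq, triv _ 9 8 (by decide +kernel) (by decide +kernel), hW.flip.eq,
            triv _ 1 0 (by decide +kernel) (by decide +kernel),
            triv _ 0 17 (by decide +kernel) (by decide +kernel),
            triv _ 17 16 (by decide +kernel) (by decide +kernel)])
    simp only [one_mul, mul_one] at h
    intro i j
    exact R'.equivariant.eq_of_eq W'.equivariant (by decide +kernel)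
      (W'.flip.eq_flip_of_mul_eq (F := R) (by decide +kernel) (by decide +kernel)
        (by decide +kernel) h)
  have WXY : ∀ i j k, i ≠ j → i ≠ k → j ≠ k → W j i = Y k j * X i j * Y i k := by
    have h : 1 * X (pathVertex 8) (pathVertex 14) * 1 * Y (pathVertex 8) (pathVertex 2) * 1 =
        X (pathVertex 7) (pathVertex 14) * 1 * Y (pathVertex 7) (pathVertex 2) * 1 *
          W (pathVertex 7) (pathVertex 8) :=
      uC_loop_hexagon (σ := σ) (p := (1, 2)) (A := ![fun _ _ => 1, X, fun _ _ => 1, Y,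
          fun _ _ => 1, W])
        (E := ![((1, 2), 2), ((1, 2), 0), ((1, 2), 1), ((0, 2), 2), ((0, 1), 0), ((1, 1), 1)])
        (h := fun k => pathVertex (![8, 7, 14, 13, 2, 1] k))
        (by
          intro k
          fin_cases k
          exacts [one, X'.equivariant, one, Y'.equivariant, one, W'.equivariant])
        (by decide +kernel) (by decide +kernel)
        (by
          intro k
          fin_cases k
          exacts [triv _ 8 7 (by decide +kernel) (by decide +kernel), hX.eq,
            triv _ 14 13 (by decide +kernel) (by decide +kernel), hY.eq,
            triv _ 2 1 (by decide +kernel) (by decide +kernel), hW.eq])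
    simp only [one_mul, mul_one] at h
    rw [← X'.mul_right (pathVertex 8) (pathVertex 7) (pathVertex 14) (by decide +kernel)
      (by decide +kernel) (by decide +kernel), mul_assoc, mul_assoc] at h
    have h' := mul_left_cancel h
    rw [← inv_mul_eq_iff_eq_mul, Y'.inv_eq (by decide +kernel), ← mul_assoc] at h'
    intro i j k hij hik hjk
    obtain ⟨π, hπ⟩ := exists_perm_apply_eq
      (injective_vecCons_three (i := pathVertex 8) (j := pathVertex 7) (k := pathVertex 2)
        (by decide +kernel) (by decide +kernel) (by decide +kernel))
      (injective_vecCons_three hij hik hjk)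
    obtain rfl : π (pathVertex 8) = i := hπ 0
    obtain rfl : π (pathVertex 7) = j := hπ 1
    obtain rfl : π (pathVertex 2) = k := hπ 2
    rw [← W'.equivariant, ← X'.equivariant, ← Y'.equivariant, ← Y'.equivariant, ← h']
    group
  have YWX : ∀ i j k, i ≠ j → i ≠ k → j ≠ k → Y j i * W k i = W k j * X i j := by
    have h : 1 * Y (pathVertex 10) (pathVertex 4) * 1 * W (pathVertex 16) (pathVertex 4) * 1 =
        Y (pathVertex 10) (pathVertex 3) * 1 * W (pathVertex 16) (pathVertex 3) * 1 *
          P (pathVertex 4) (pathVertex 3) :=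
      uC_loop_hexagon (σ := σ) (p := (2, 1)) (A := ![fun _ _ => 1, fun i j => Y j i,
          fun _ _ => 1, fun i j => W j i, fun _ _ => 1, fun i j => P j i])
        (E := ![((2, 1), 2), ((2, 1), 0), ((2, 1), 1), ((1, 1), 2), ((1, 0), 0), ((2, 0), 1)])
        (h := fun k => pathVertex (![4, 3, 10, 9, 16, 15] k))
        (by
          intro k
          fin_cases k
          exacts [one, Y'.flip.equivariant, one, W'.flip.equivariant, one, P'.flip.equivariant])
        (by decide +kernel) (by decide +kernel)
        (by
          intro k
          fin_cases k
          exacts [triv _ 4 3 (by decide +kernel) (by decide +kernel),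
            hQ.flip.eq.trans (by rw [QY (by decide +kernel)]; rfl),
            triv _ 10 9 (by decide +kernel) (by decide +kernel),
            hR.flip.eq.trans (by rw [RW (by decide +kernel)]; rfl),
            triv _ 16 15 (by decide +kernel) (by decide +kernel), hP.flip.eq])
    simp only [one_mul, mul_one] at h
    rw [PX (by decide +kernel), ← Y'.mul_left (pathVertex 10) (pathVertex 3) (pathVertex 4)
      (by decide +kernel) (by decide +kernel) (by decide +kernel), mul_assoc, mul_assoc] at h
    have h' := mul_left_cancel h
    intro i j k hij hik hjk
    obtain ⟨π, hπ⟩ := exists_perm_apply_eq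
      (injective_vecCons_three (i := pathVertex 4) (j := pathVertex 3) (k := pathVertex 16)
        (by decide +kernel) (by decide +kernel) (by decide +kernel))
      (injective_vecCons_three hij hik hjk)
    obtain rfl : π (pathVertex 4) = i := hπ 0
    obtain rfl : π (pathVertex 3) = j := hπ 1
    obtain rfl : π (pathVertex 16) = k := hπ 2
    rw [← W'.equivariant, ← W'.equivariant, ← X'.equivariant, ← Y'.equivariant]
    simp only [mul_assoc, inv_mul_cancel_left, mul_right_inj]
    simp only [← mul_assoc, h']
  refine ⟨X, Y, X', Y', ?_, ?_, ?_⟩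
  · have h : Commute (X (pathVertex 7) (pathVertex 14)) (Y (pathVertex 13) (pathVertex 2)) := by
      have hu := (uC_commute (e := ((1, 2), 0)) (f := ((0, 2), 2)) (by decide +kernel)).eq
      have hst := (Perm.disjoint_swap_swap (x := pathVertex 7) (y := pathVertex 14)
        (z := pathVertex 13) (t := pathVertex 2) (by decide +kernel)).commute.map σ
      have hs := Y'.equivariant (swap (pathVertex 7) (pathVertex 14)) (pathVertex 13)
        (pathVertex 2)
      have ht := X'.equivariant (swap (pathVertex 13) (pathVertex 2)) (pathVertex 7)
        (pathVertex 14)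
      rw [swap_apply_of_ne_of_ne (by decide +kernel) (by decide +kernel),
        swap_apply_of_ne_of_ne (by decide +kernel) (by decide +kernel),
        mul_inv_eq_iff_eq_mul] at hs ht
      rw [hX.eq, hY.eq, Commute.mul_mul_mul_comm hs, Commute.mul_mul_mul_comm ht,
        hst.eq] at hu
      exact mul_right_cancel hu
    intro i j k l hij hik hil hjk hjl hkl
    obtain ⟨π, hπ⟩ := exists_perm_apply_eq
      (injective_vecCons_four (i := pathVertex 7) (j := pathVertex 14) (k := pathVertex 13)
        (l := pathVertex 2) (by decide +kernel) (by decide +kernel) (by decide +kernel)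
        (by decide +kernel) (by decide +kernel) (by decide +kernel))
      (injective_vecCons_four hij hik hil hjk hjl hkl)
    obtain rfl : π (pathVertex 7) = i := hπ 0
    obtain rfl : π (pathVertex 14) = j := hπ 1
    obtain rfl : π (pathVertex 13) = k := hπ 2
    obtain rfl : π (pathVertex 2) = l := hπ 3
    rw [← X'.equivariant, ← Y'.equivariant]
    exact (Commute.conj_iff _).2 h
  · intro i j k l hij hik hil hjk hjl hkl
    have h := YWX i j k hij hik hjk
    rw [WXY i k l hik hil hkl, WXY j k l hjk hjl hkl, ← X'.mul_right i j k hij hjk hik,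
      mul_assoc (Y l k), ← mul_assoc (Y j i), (Y'.commute hij.symm hkl.symm).eq] at h
    refine mul_left_cancel (a := Y l k) ?_
    simpa only [mul_assoc] using h
  · set A := Subgroup.closure {g | ∃ i j, i ≠ j ∧ (g = X i j ∨ g = Y i j)} with hA
    have XA : ∀ i j, i ≠ j → X i j ∈ A := fun i j hij =>
      Subgroup.subset_closure ⟨i, j, hij, Or.inl rfl⟩
    have YA : ∀ i j, i ≠ j → Y i j ∈ A := fun i j hij =>
      Subgroup.subset_closure ⟨i, j, hij, Or.inr rfl⟩
    have WA : ∀ i j, i ≠ j → W i j ∈ A := by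
      intro i j hij
      obtain ⟨k, hi, hj, -⟩ := exists_ne_five (V := VT) (by simp) i j i i i
      rw [WXY j i k hij.symm hj.symm hi.symm]
      exact A.mul_mem (A.mul_mem (YA _ _ hi) (XA _ _ hij.symm)) (YA _ _ hj.symm)
    have mem : ∀ {e i j F}, IsLoopOf σ e i j F → F i j ∈ A →
        ((endA e = i ∧ endB e = j) ∨ (endA e = j ∧ endB e = i)) →
        uC e * (σ (tE e))⁻¹ ∈ A := by
      intro e i j F hF h he
      rwa [hF.eq, tE_eq_swap he, mul_inv_cancel_right]
    have hcases : ∀ e, e ∈ pathEdges ++ chordEdges ∨ e ∈ cutEdges := by decide +kernel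
    intro e
    rcases hcases e with he | he
    · rw [hσ e he, mul_inv_cancel]
      exact A.one_mem
    · simp only [cutEdges, List.mem_cons, List.not_mem_nil, or_false] at he
      rcases he with rfl | rfl | rfl | rfl | rfl | rfl
      · exact mem hX (XA _ _ (by decide +kernel)) (by decide +kernel)
      · exact mem hY (YA _ _ (by decide +kernel)) (by decide +kernel)
      · exact mem hW (WA _ _ (by decide +kernel)) (by decide +kernel)
      · exact mem hP (by rw [PX (by decide +kernel)]; exact XA _ _ (by decide +kernel))
          (by decide +kernel)
      · exact mem hQ (by rw [QY (by decide +kernel)]; exact YA _ _ (by decide +kernel))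
          (by decide +kernel)
      · exact mem hR (by rw [RW (by decide +kernel)]; exact WA _ _ (by decide +kernel))
          (by decide +kernel)

theorem ker_le_closure {ψ : Cgrp →* Perm VT} {σ : Perm VT →* Cgrp}
    (hψ : ∀ e, ψ (uC e) = tE e) {X Y : VT → VT → Cgrp} (hX : IsLoopFamily σ X)
    (hY : IsLoopFamily σ Y)
    (h : ∀ e, uC e * (σ (tE e))⁻¹ ∈
      Subgroup.closure {g | ∃ i j, i ≠ j ∧ (g = X i j ∨ g = Y i j)}) :
    ψ.ker ≤ Subgroup.closure {g | ∃ i j, i ≠ j ∧ (g = X i j ∨ g = Y i j)} := by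
  set A := Subgroup.closure {g | ∃ i j, i ≠ j ∧ (g = X i j ∨ g = Y i j)} with hA
  have conj : ∀ π, ∀ a ∈ A, σ π * a * (σ π)⁻¹ ∈ A := by
    intro π a ha
    induction ha using Subgroup.closure_induction with
    | mem x hx =>
      obtain ⟨i, j, hij, rfl | rfl⟩ := hx
      · rw [hX.equivariant]
        exact Subgroup.subset_closure ⟨_, _, π.injective.ne hij, Or.inl rfl⟩
      · rw [hY.equivariant]
        exact Subgroup.subset_closure ⟨_, _, π.injective.ne hij, Or.inr rfl⟩
    | one => simp
    | mul x y _ _ hx hy => simpa [mul_assoc] using A.mul_mem hx hy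
    | inv x _ hx => simpa [mul_assoc] using A.inv_mem hx
  have all : ∀ g ∈ Subgroup.closure (Set.range uC), g * (σ (ψ g))⁻¹ ∈ A := by
    intro g hg
    induction hg using Subgroup.closure_induction with
    | mem x hx =>
      obtain ⟨e, rfl⟩ := hx
      rw [hψ]
      exact h e
    | one => simp
    | mul x y _ _ hx hy =>
      have := A.mul_mem hx (conj (ψ x) _ hy)
      simpa [mul_assoc] using this
    | inv x _ hx =>
      have := conj (ψ x)⁻¹ _ (A.inv_mem hx)
      simpa [mul_assoc] using this
  intro g hg
  have hg' := all g (by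
    rw [show Set.range uC = Set.range (PresentedGroup.of (rels := CRels)) from rfl,
      PresentedGroup.closure_range_of]
    trivial)
  rwa [MonoidHom.mem_ker.1 hg, map_one, inv_one, mul_one] at hg'


theorem upperCentralSeries_ker_two (ψ : Cgrp →* Perm VT) (hψ : ∀ e, ψ (uC e) = tE e) :
    Subgroup.upperCentralSeries ψ.ker 2 = ⊤ := by
  obtain ⟨σ, hψσ, hσ⟩ := exists_section_tE ψ hψ
  obtain ⟨X, Y, hX, hY, hXY, hrel, h⟩ := exists_isLoopFamily_pair hσ
  obtain ⟨z, hz, hzXY⟩ := exists_central_commutator (by simp) hX hY hXY hrel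
  refine upperCentralSeries_two_eq_top (z := z) ?_ ?_ (ker_le_closure hψ hX hY h)
  · rintro _ ⟨i, j, hij, rfl | rfl⟩
    exacts [(hz i j hij).1, (hz i j hij).2]
  · rintro _ ⟨i, j, hij, rfl | rfl⟩ _ ⟨k, l, hkl, rfl | rfl⟩
    exacts [(hX.commute hij hkl).commuteUpTo z, hzXY i j k l hij hkl,
      (hzXY k l i j hkl hij).symm, (hY.commute hij hkl).commuteUpTo z]

end Hexagons

/-- The kernel of `ψ_C : C → S₁₈` is nilpotent of class at most 2 and has
finite index `18!` in `C`; in particular `C` is virtually nilpotent. -/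
theorem stmt18 (ψ : Cgrp →* Equiv.Perm VT)
    (hψ : ∀ e : ET, ψ (uC e) = tE e) (hsurj : Function.Surjective ψ) :
    upperCentralSeries ↥ψ.ker 2 = ⊤ ∧
      ψ.ker.index = Nat.factorial 18 ∧
      ∃ N : Subgroup Cgrp, N.FiniteIndex ∧ Group.IsNilpotent ↥N := by
  have hnil : Subgroup.upperCentralSeries ψ.ker 2 = ⊤ := upperCentralSeries_ker_two ψ hψ
  have hindex : ψ.ker.index = Nat.factorial 18 := by
    rw [Subgroup.index_ker, MonoidHom.range_eq_top.2 hsurj, Subgroup.card_top, Nat.card_perm]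
    simp
  exact ⟨hnil, hindex, ψ.ker, ⟨hindex ▸ Nat.factorial_ne_zero 18⟩, ⟨2, hnil⟩⟩
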